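/- arXiv:math/0406011 — 2 statements merged into one kernel-verified Lean document; each statement's English description precedes it below -/
import Mathlib

section
/- The group Spin(7) = { B : ℝ⁸ → ℝ⁸ invertible linear : B*Ω₀ = Ω₀ } is a compact subset of the space of continuous linear endomorphisms of ℝ⁸ (equivalently, the corresponding set of 8×8 real matrices is compact). -/
open scoped RealInnerProductSpace

noncomputable section

/-- ℝ⁸ with its standard Euclidean inner product. -/
abbrev E8 := EuclideanSpace ℝ (Fin 8)

/-- The coordinate 4-form dx_i ∧ dx_j ∧ dx_k ∧ dx_l on ℝ⁸ (indices 0,…,7 for x₁,…,x₈). -/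
def quad8 (i j k l : Fin 8) (a b c d : E8) : ℝ :=
  Matrix.det !![a i, a j, a k, a l; b i, b j, b k, b l;
                c i, c j, c k, c l; d i, d j, d k, d l]

/-- The Spin(7) 4-form Ω₀ = dx₁₂₃₄ + dx₁₂₅₆ + dx₁₂₇₈ + dx₁₃₅₇ − dx₁₃₆₈ − dx₁₄₅₈ − dx₁₄₆₇
    − dx₂₃₅₈ − dx₂₃₆₇ − dx₂₄₅₇ + dx₂₄₆₈ + dx₃₄₅₆ + dx₃₄₇₈ + dx₅₆₇₈. -/
def Omega0 (a b c d : E8) : ℝ :=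
  quad8 0 1 2 3 a b c d + quad8 0 1 4 5 a b c d + quad8 0 1 6 7 a b c d
    + quad8 0 2 4 6 a b c d - quad8 0 2 5 7 a b c d - quad8 0 3 4 7 a b c d
    - quad8 0 3 5 6 a b c d - quad8 1 2 4 7 a b c d - quad8 1 2 5 6 a b c d
    - quad8 1 3 4 6 a b c d + quad8 1 3 5 7 a b c d + quad8 2 3 4 5 a b c d
    + quad8 2 3 6 7 a b c d + quad8 4 5 6 7 a b c d

def Wmat (u v : Fin 8 → ℝ) : Matrix (Fin 8) (Fin 8) ℝ :=
  !![0,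
     (u 2 * v 3 - u 3 * v 2) + (u 4 * v 5 - u 5 * v 4) + (u 6 * v 7 - u 7 * v 6),
     -(u 1 * v 3 - u 3 * v 1) + (u 4 * v 6 - u 6 * v 4) - (u 5 * v 7 - u 7 * v 5),
     (u 1 * v 2 - u 2 * v 1) - (u 4 * v 7 - u 7 * v 4) - (u 5 * v 6 - u 6 * v 5),
     -(u 1 * v 5 - u 5 * v 1) - (u 2 * v 6 - u 6 * v 2) + (u 3 * v 7 - u 7 * v 3),
     (u 1 * v 4 - u 4 * v 1) + (u 2 * v 7 - u 7 * v 2) + (u 3 * v 6 - u 6 * v 3),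
     -(u 1 * v 7 - u 7 * v 1) + (u 2 * v 4 - u 4 * v 2) - (u 3 * v 5 - u 5 * v 3),
     (u 1 * v 6 - u 6 * v 1) - (u 2 * v 5 - u 5 * v 2) - (u 3 * v 4 - u 4 * v 3);
     -(u 2 * v 3 - u 3 * v 2) - (u 4 * v 5 - u 5 * v 4) - (u 6 * v 7 - u 7 * v 6),
     0,
     (u 0 * v 3 - u 3 * v 0) - (u 4 * v 7 - u 7 * v 4) - (u 5 * v 6 - u 6 * v 5),
     -(u 0 * v 2 - u 2 * v 0) - (u 4 * v 6 - u 6 * v 4) + (u 5 * v 7 - u 7 * v 5),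
     (u 0 * v 5 - u 5 * v 0) + (u 2 * v 7 - u 7 * v 2) + (u 3 * v 6 - u 6 * v 3),
     -(u 0 * v 4 - u 4 * v 0) + (u 2 * v 6 - u 6 * v 2) - (u 3 * v 7 - u 7 * v 3),
     (u 0 * v 7 - u 7 * v 0) - (u 2 * v 5 - u 5 * v 2) - (u 3 * v 4 - u 4 * v 3),
     -(u 0 * v 6 - u 6 * v 0) - (u 2 * v 4 - u 4 * v 2) + (u 3 * v 5 - u 5 * v 3);
     (u 1 * v 3 - u 3 * v 1) - (u 4 * v 6 - u 6 * v 4) + (u 5 * v 7 - u 7 * v 5),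
     -(u 0 * v 3 - u 3 * v 0) + (u 4 * v 7 - u 7 * v 4) + (u 5 * v 6 - u 6 * v 5),
     0,
     (u 0 * v 1 - u 1 * v 0) + (u 4 * v 5 - u 5 * v 4) + (u 6 * v 7 - u 7 * v 6),
     (u 0 * v 6 - u 6 * v 0) - (u 1 * v 7 - u 7 * v 1) - (u 3 * v 5 - u 5 * v 3),
     -(u 0 * v 7 - u 7 * v 0) - (u 1 * v 6 - u 6 * v 1) + (u 3 * v 4 - u 4 * v 3),
     -(u 0 * v 4 - u 4 * v 0) + (u 1 * v 5 - u 5 * v 1) - (u 3 * v 7 - u 7 * v 3),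
     (u 0 * v 5 - u 5 * v 0) + (u 1 * v 4 - u 4 * v 1) + (u 3 * v 6 - u 6 * v 3);
     -(u 1 * v 2 - u 2 * v 1) + (u 4 * v 7 - u 7 * v 4) + (u 5 * v 6 - u 6 * v 5),
     (u 0 * v 2 - u 2 * v 0) + (u 4 * v 6 - u 6 * v 4) - (u 5 * v 7 - u 7 * v 5),
     -(u 0 * v 1 - u 1 * v 0) - (u 4 * v 5 - u 5 * v 4) - (u 6 * v 7 - u 7 * v 6),
     0,
     -(u 0 * v 7 - u 7 * v 0) - (u 1 * v 6 - u 6 * v 1) + (u 2 * v 5 - u 5 * v 2),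
     -(u 0 * v 6 - u 6 * v 0) + (u 1 * v 7 - u 7 * v 1) - (u 2 * v 4 - u 4 * v 2),
     (u 0 * v 5 - u 5 * v 0) + (u 1 * v 4 - u 4 * v 1) + (u 2 * v 7 - u 7 * v 2),
     (u 0 * v 4 - u 4 * v 0) - (u 1 * v 5 - u 5 * v 1) - (u 2 * v 6 - u 6 * v 2);
     (u 1 * v 5 - u 5 * v 1) + (u 2 * v 6 - u 6 * v 2) - (u 3 * v 7 - u 7 * v 3),
     -(u 0 * v 5 - u 5 * v 0) - (u 2 * v 7 - u 7 * v 2) - (u 3 * v 6 - u 6 * v 3),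
     -(u 0 * v 6 - u 6 * v 0) + (u 1 * v 7 - u 7 * v 1) + (u 3 * v 5 - u 5 * v 3),
     (u 0 * v 7 - u 7 * v 0) + (u 1 * v 6 - u 6 * v 1) - (u 2 * v 5 - u 5 * v 2),
     0,
     (u 0 * v 1 - u 1 * v 0) + (u 2 * v 3 - u 3 * v 2) + (u 6 * v 7 - u 7 * v 6),
     (u 0 * v 2 - u 2 * v 0) - (u 1 * v 3 - u 3 * v 1) - (u 5 * v 7 - u 7 * v 5),
     -(u 0 * v 3 - u 3 * v 0) - (u 1 * v 2 - u 2 * v 1) + (u 5 * v 6 - u 6 * v 5);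
     -(u 1 * v 4 - u 4 * v 1) - (u 2 * v 7 - u 7 * v 2) - (u 3 * v 6 - u 6 * v 3),
     (u 0 * v 4 - u 4 * v 0) - (u 2 * v 6 - u 6 * v 2) + (u 3 * v 7 - u 7 * v 3),
     (u 0 * v 7 - u 7 * v 0) + (u 1 * v 6 - u 6 * v 1) - (u 3 * v 4 - u 4 * v 3),
     (u 0 * v 6 - u 6 * v 0) - (u 1 * v 7 - u 7 * v 1) + (u 2 * v 4 - u 4 * v 2),
     -(u 0 * v 1 - u 1 * v 0) - (u 2 * v 3 - u 3 * v 2) - (u 6 * v 7 - u 7 * v 6),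
     0,
     -(u 0 * v 3 - u 3 * v 0) - (u 1 * v 2 - u 2 * v 1) + (u 4 * v 7 - u 7 * v 4),
     -(u 0 * v 2 - u 2 * v 0) + (u 1 * v 3 - u 3 * v 1) - (u 4 * v 6 - u 6 * v 4);
     (u 1 * v 7 - u 7 * v 1) - (u 2 * v 4 - u 4 * v 2) + (u 3 * v 5 - u 5 * v 3),
     -(u 0 * v 7 - u 7 * v 0) + (u 2 * v 5 - u 5 * v 2) + (u 3 * v 4 - u 4 * v 3),
     (u 0 * v 4 - u 4 * v 0) - (u 1 * v 5 - u 5 * v 1) + (u 3 * v 7 - u 7 * v 3),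
     -(u 0 * v 5 - u 5 * v 0) - (u 1 * v 4 - u 4 * v 1) - (u 2 * v 7 - u 7 * v 2),
     -(u 0 * v 2 - u 2 * v 0) + (u 1 * v 3 - u 3 * v 1) + (u 5 * v 7 - u 7 * v 5),
     (u 0 * v 3 - u 3 * v 0) + (u 1 * v 2 - u 2 * v 1) - (u 4 * v 7 - u 7 * v 4),
     0,
     (u 0 * v 1 - u 1 * v 0) + (u 2 * v 3 - u 3 * v 2) + (u 4 * v 5 - u 5 * v 4);
     -(u 1 * v 6 - u 6 * v 1) + (u 2 * v 5 - u 5 * v 2) + (u 3 * v 4 - u 4 * v 3),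
     (u 0 * v 6 - u 6 * v 0) + (u 2 * v 4 - u 4 * v 2) - (u 3 * v 5 - u 5 * v 3),
     -(u 0 * v 5 - u 5 * v 0) - (u 1 * v 4 - u 4 * v 1) - (u 3 * v 6 - u 6 * v 3),
     -(u 0 * v 4 - u 4 * v 0) + (u 1 * v 5 - u 5 * v 1) + (u 2 * v 6 - u 6 * v 2),
     (u 0 * v 3 - u 3 * v 0) + (u 1 * v 2 - u 2 * v 1) - (u 5 * v 6 - u 6 * v 5),
     (u 0 * v 2 - u 2 * v 0) - (u 1 * v 3 - u 3 * v 1) + (u 4 * v 6 - u 6 * v 4),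
     -(u 0 * v 1 - u 1 * v 0) - (u 2 * v 3 - u 3 * v 2) - (u 4 * v 5 - u 5 * v 4),
     0]

def Nmat (u v : Fin 8 → ℝ) : Matrix (Fin 8) (Fin 8) ℝ :=
  Matrix.of fun i j => u i * v j - v i * u j

lemma quad8_eq (i j k l : Fin 8) (a b c d : E8) : quad8 i j k l a b c d =
    (a i * b j - a j * b i) * (c k * d l - c l * d k)
    - (a i * b k - a k * b i) * (c j * d l - c l * d j)
    + (a i * b l - a l * b i) * (c j * d k - c k * d j)
    + (a j * b k - a k * b j) * (c i * d l - c l * d i)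
    - (a j * b l - a l * b j) * (c i * d k - c k * d i)
    + (a k * b l - a l * b k) * (c i * d j - c j * d i) := by
  simp [quad8, Matrix.det_succ_row_zero, Fin.sum_univ_succ, Fin.succAbove]
  ring

set_option maxHeartbeats 4000000 in
lemma Omega0_eq (a b c d : E8) :
    Omega0 a b c d = c.ofLp ⬝ᵥ (Wmat a.ofLp b.ofLp).mulVec d.ofLp := by
  simp only [Omega0, quad8_eq, dotProduct, Matrix.mulVec, Fin.sum_univ_eight]
  simp [Wmat]
  ring

set_option maxHeartbeats 4000000 in
lemma W_sq (u v : Fin 8 → ℝ) : Wmat u v * Wmat u v + Nmat u v * Nmat u v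
    = (-((u ⬝ᵥ u) * (v ⬝ᵥ v) - (u ⬝ᵥ v) ^ 2)) • (1 : Matrix (Fin 8) (Fin 8) ℝ) := by
  ext i j
  simp only [Matrix.add_apply, Matrix.mul_apply, Matrix.smul_apply, Fin.sum_univ_eight, Nmat,
    Matrix.of_apply, dotProduct]
  fin_cases i <;> fin_cases j <;> simp [Wmat] <;> ring

lemma N_eq (u v : Fin 8 → ℝ) :
    Nmat u v = Matrix.vecMulVec u v - Matrix.vecMulVec v u := by
  ext i j; simp [Nmat, Matrix.vecMulVec_apply]

lemma W_N (u v : Fin 8 → ℝ) : Wmat u v * Nmat u v = 0 := by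
  have hu : (Wmat u v).mulVec u = 0 := by
    ext i
    simp only [Matrix.mulVec, dotProduct, Fin.sum_univ_eight]
    fin_cases i <;> simp [Wmat] <;> ring
  have hv : (Wmat u v).mulVec v = 0 := by
    ext i
    simp only [Matrix.mulVec, dotProduct, Fin.sum_univ_eight]
    fin_cases i <;> simp [Wmat] <;> ring
  rw [N_eq, mul_sub, Matrix.mul_vecMulVec, Matrix.mul_vecMulVec, hu, hv]
  simp

set_option maxHeartbeats 4000000 in
lemma N_W (u v : Fin 8 → ℝ) : Nmat u v * Wmat u v = 0 := by
  have hW : (Wmat u v).transpose = - Wmat u v := by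
    ext i j
    fin_cases i <;> fin_cases j <;> simp [Wmat] <;> ring
  have hN : (Nmat u v).transpose = - Nmat u v := by
    ext i j
    simp [Nmat]; ring
  have := congrArg Matrix.transpose (W_N u v)
  rw [Matrix.transpose_mul, hW, hN] at this
  simpa using this

lemma det_rankone (c : ℝ) (u : Fin 8 → ℝ) (hu : u ⬝ᵥ u = 1) :
    (1 + c • Matrix.vecMulVec u u).det = 1 + c := by
  have := Matrix.det_one_add_replicateCol_mul_replicateRow (ι := Unit) (c • u) u
  rw [← Matrix.vecMulVec_eq, Matrix.smul_vecMulVec, dotProduct_smul, hu] at this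
  simpa using this

lemma key (A : Matrix (Fin 8) (Fin 8) ℝ)
    (H : ∀ u v, A.transpose * Wmat (A.mulVec u) (A.mulVec v) * A = Wmat u v)
    (u v : Fin 8 → ℝ) (s t : ℝ) (huu : u ⬝ᵥ u = 1) (hvv : v ⬝ᵥ v = 1) (huv : u ⬝ᵥ v = 0)
    (hs : (A.transpose * A).mulVec u = s • u) (ht : (A.transpose * A).mulVec v = t • v) :
    A.det ^ 4 * (s * t) ^ 8 = (s * t) ^ 4 := by
  have hvu : v ⬝ᵥ u = 0 := by rw [dotProduct_comm]; exact huv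
  have inn : ∀ x y : Fin 8 → ℝ, A.mulVec x ⬝ᵥ A.mulVec y = x ⬝ᵥ (A.transpose * A).mulVec y := by
    intro x y
    rw [← Matrix.mulVec_mulVec, Matrix.dotProduct_mulVec x, Matrix.vecMul_transpose]
  have hN : A.transpose * Nmat (A.mulVec u) (A.mulVec v) * A = (s * t) • Nmat u v := by
    have h1 : ∀ x, Matrix.vecMul (A.mulVec x) A = (A.transpose * A).mulVec x := by
      intro x
      rw [← Matrix.mulVec_mulVec, Matrix.mulVec_transpose]
    rw [N_eq, N_eq, mul_sub, sub_mul, Matrix.mul_vecMulVec, Matrix.mul_vecMulVec,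
      Matrix.vecMulVec_mul, Matrix.vecMulVec_mul, Matrix.mulVec_mulVec, Matrix.mulVec_mulVec,
      h1, h1, hs, ht]
    ext i j
    simp [Matrix.vecMulVec_apply]; ring
  set W' := Wmat (A.mulVec u) (A.mulVec v) with hW'
  set N' := Nmat (A.mulVec u) (A.mulVec v) with hN'
  have e1 : A.det ^ 2 * (W' + N').det = (Wmat u v + (s * t) • Nmat u v).det := by
    rw [← hN, ← H u v, ← add_mul, ← mul_add, Matrix.det_mul, Matrix.det_mul,
      Matrix.det_transpose]
    ring
  have e2 : (W' + N').det ^ 2 = (s * t) ^ 8 := by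
    have : (W' + N') * (W' + N') = (-(s * t)) • (1 : Matrix (Fin 8) (Fin 8) ℝ) := by
      rw [add_mul, mul_add, mul_add, W_N, N_W, add_zero, zero_add, W_sq, inn, inn, inn, hs, ht]
      simp [huu, hvv, huv]
    rw [sq, ← Matrix.det_mul, this, Matrix.det_smul]
    simp
    ring
  have e3 : (Wmat u v + (s * t) • Nmat u v).det ^ 2 = (s * t) ^ 4 := by
    have hNN : Nmat u v * Nmat u v = - (Matrix.vecMulVec u u + Matrix.vecMulVec v v) := by
      rw [N_eq, mul_sub, sub_mul, sub_mul]
      simp only [Matrix.vecMulVec_mul_vecMulVec, huu, hvv, huv, hvu]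
      simp
      abel
    have hsq := W_sq u v
    rw [huu, hvv, huv] at hsq
    have : (Wmat u v + (s * t) • Nmat u v) * (Wmat u v + (s * t) • Nmat u v)
        = - ((1 + ((s * t) ^ 2 - 1) • Matrix.vecMulVec u u) *
            (1 + ((s * t) ^ 2 - 1) • Matrix.vecMulVec v v)) := by
      have hw : Wmat u v * Wmat u v = -1 - Nmat u v * Nmat u v := by
        rw [eq_sub_iff_add_eq, hsq]; simp
      have h0 : Matrix.vecMulVec u u * Matrix.vecMulVec v v = 0 := by
        rw [Matrix.vecMulVec_mul_vecMulVec, huv]; simp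
      rw [add_mul, mul_add, mul_add, Matrix.mul_smul, Matrix.smul_mul, W_N, N_W, smul_zero,
        add_zero, zero_add, Matrix.smul_mul, Matrix.mul_smul, hw, hNN]
      rw [add_mul, mul_add, mul_add, smul_mul_smul_comm, h0]
      simp
      module
    rw [sq, ← Matrix.det_mul, this, Matrix.det_neg, Matrix.det_mul, det_rankone _ _ huu,
      det_rankone _ _ hvv]
    simp
    ring
  calc A.det ^ 4 * (s * t) ^ 8 = (A.det ^ 2 * (W' + N').det) ^ 2 := by rw [← e2]; ring
    _ = _ := by rw [e1, e3]

lemma reals (d : ℝ) (s : Fin 8 → ℝ) (hs : ∀ i, 0 < s i) (hd : d ^ 2 = ∏ i, s i)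
    (h : ∀ i j, i ≠ j → d ^ 4 * (s i * s j) ^ 8 = (s i * s j) ^ 4) : ∀ i, s i = 1 := by
  have hp : 0 < d ^ 2 := hd ▸ Finset.prod_pos fun i _ => hs i
  have h2 : ∀ i j, i ≠ j → d ^ 2 * (s i * s j) ^ 2 = 1 := by
    intro i j hij
    have hpos := mul_pos (hs i) (hs j)
    have h1 : (d ^ 2 * (s i * s j) ^ 2) ^ 2 = 1 := by
      have : (s i * s j) ^ 4 ≠ 0 := by positivity
      apply mul_right_cancel₀ this
      linear_combination h i j hij
    exact (pow_eq_one_iff_of_nonneg (by positivity) two_ne_zero).1 h1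
  have h3 : ∀ i j k, i ≠ j → i ≠ k → s j = s k := by
    intro i j k hij hik
    have e : (s j) ^ 2 = (s k) ^ 2 := by
      have : d ^ 2 * s i ^ 2 ≠ 0 := (mul_pos hp (pow_pos (hs i) 2)).ne'
      apply mul_left_cancel₀ this
      linear_combination h2 i j hij - h2 i k hik
    exact (pow_left_inj₀ (hs j).le (hs k).le two_ne_zero).1 e
  have h4 : ∀ j k, s j = s k := by
    intro j k
    obtain ⟨i, hi⟩ : ∃ i : Fin 8, i ≠ j ∧ i ≠ k := by
      revert j k; decide
    exact h3 i j k hi.1 hi.2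
  intro i
  obtain ⟨j, hj⟩ : ∃ j : Fin 8, i ≠ j := by
    revert i; decide
  have h5 := h2 i j hj
  rw [hd, h4 j i, Finset.prod_congr rfl (fun k _ => h4 k i)] at h5
  simp at h5
  have : s i ^ 12 = 1 := by linear_combination h5
  exact (pow_eq_one_iff_of_nonneg (hs i).le (by norm_num)).1 this

lemma orth (A : Matrix (Fin 8) (Fin 8) ℝ) (hA : A.det ≠ 0)
    (H : ∀ u v, A.transpose * Wmat (A.mulVec u) (A.mulVec v) * A = Wmat u v) :
    A.transpose * A = 1 := by
  have hU : IsUnit A := (Matrix.isUnit_iff_isUnit_det A).2 hA.isUnit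
  have hP : (A.transpose * A).PosDef := by
    have := Matrix.PosDef.conjTranspose_mul_self A (Matrix.mulVec_injective_of_isUnit hU)
    simpa using this
  have hH := hP.isHermitian
  have h1 : ∀ i, hH.eigenvalues i = 1 := by
    apply reals A.det
    · exact hP.eigenvalues_pos
    · have := hH.det_eq_prod_eigenvalues
      rw [Matrix.det_mul, Matrix.det_transpose] at this
      simp only [RCLike.ofReal_real_eq_id, id] at this
      rw [← this]; ring
    · intro i j hij
      have ho := hH.eigenvectorBasis.orthonormal
      have hin : ∀ a b, (hH.eigenvectorBasis a).ofLp ⬝ᵥ (hH.eigenvectorBasis b).ofLp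
          = if a = b then 1 else 0 := by
        intro a b
        have := orthonormal_iff_ite.1 ho b a
        rw [EuclideanSpace.inner_eq_star_dotProduct] at this
        simpa [eq_comm] using this
      refine key A H (hH.eigenvectorBasis i).ofLp (hH.eigenvectorBasis j).ofLp _ _ ?_ ?_ ?_
        (hH.mulVec_eigenvectorBasis i) (hH.mulVec_eigenvectorBasis j)
      · simp [hin]
      · simp [hin]
      · simp [hin, hij]
  have h2 := hH.spectral_theorem
  have h3 : (RCLike.ofReal ∘ hH.eigenvalues : Fin 8 → ℝ) = fun _ => 1 := by
    ext i; simp [h1]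
  rw [h3] at h2
  rw [h2, Matrix.diagonal_one, map_one]

lemma isom (B : E8 →L[ℝ] E8) (hb : Function.Bijective B)
    (h : ∀ v₁ v₂ v₃ v₄ : E8,
        Omega0 (B v₁) (B v₂) (B v₃) (B v₄) = Omega0 v₁ v₂ v₃ v₄) (v : E8) :
    ‖B v‖ = ‖v‖ := by
  set A : Matrix (Fin 8) (Fin 8) ℝ := Matrix.toEuclideanLin.symm (B : E8 →ₗ[ℝ] E8) with hA
  have hBA : ∀ x : E8, (B x).ofLp = A.mulVec x.ofLp := by
    intro x
    have : (B : E8 →ₗ[ℝ] E8) = Matrix.toEuclideanLin A := by simp [hA]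
    have h2 := congrArg (fun f : E8 →ₗ[ℝ] E8 => (f x).ofLp) this
    simpa using h2
  have hdet : A.det ≠ 0 := by
    intro h0
    obtain ⟨x, hx, hx0⟩ := Matrix.exists_mulVec_eq_zero_iff.2 h0
    apply hx
    have : B (WithLp.toLp 2 x) = 0 := by
      ext i
      rw [hBA]; simp [hx0]
    have h3 : (WithLp.toLp 2 x : E8) = 0 := hb.1 (by rw [this, map_zero])
    simpa using congrArg WithLp.ofLp h3
  have horth := orth A hdet (by
    intro x y
    rw [← Matrix.ext_iff]
    intro i j
    have := h (WithLp.toLp 2 x) (WithLp.toLp 2 y) (WithLp.toLp 2 (Pi.single i 1))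
      (WithLp.toLp 2 (Pi.single j 1))
    rw [Omega0_eq, Omega0_eq, hBA, hBA, hBA, hBA] at this
    simp only [Matrix.mulVec_mulVec] at this
    rw [← Matrix.vecMul_transpose, ← Matrix.dotProduct_mulVec, Matrix.mulVec_mulVec,
      ← mul_assoc] at this
    simpa using this)
  have e : ∀ x : E8, ‖x‖ ^ 2 = x.ofLp ⬝ᵥ x.ofLp := by
    intro x
    rw [EuclideanSpace.norm_sq_eq]
    simp [dotProduct, sq]
  have : ‖B v‖ ^ 2 = ‖v‖ ^ 2 := by
    rw [e, e, hBA]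
    nth_rewrite 1 [← Matrix.vecMul_transpose]
    rw [← Matrix.dotProduct_mulVec, Matrix.mulVec_mulVec, horth, Matrix.one_mulVec]
  exact (pow_left_inj₀ (norm_nonneg _) (norm_nonneg _) two_ne_zero).1 this

lemma cont_Omega0 (a b c d : E8) :
    Continuous fun B : E8 →L[ℝ] E8 => Omega0 (B a) (B b) (B c) (B d) := by
  have hc : ∀ (x : E8) (i : Fin 8), Continuous fun B : E8 →L[ℝ] E8 => (B x).ofLp i := by
    intro x i
    have : Continuous fun B : E8 →L[ℝ] E8 => B x := by fun_prop
    exact (EuclideanSpace.proj (𝕜 := ℝ) i).continuous.comp this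
  have hq : ∀ i j k l, Continuous fun B : E8 →L[ℝ] E8 => quad8 i j k l (B a) (B b) (B c) (B d) := by
    intro i j k l
    unfold quad8
    apply Continuous.matrix_det
    apply continuous_matrix
    intro p q
    fin_cases p <;> fin_cases q <;> exact hc _ _
  unfold Omega0
  fun_prop (disch := assumption)

/-- Spin(7), the group of invertible linear maps of ℝ⁸ preserving Ω₀, is a compact subset
of the space of continuous linear endomorphisms of ℝ⁸. -/
theorem spin7_isCompact :
    IsCompact {B : E8 →L[ℝ] E8 | Function.Bijective B ∧
      ∀ v₁ v₂ v₃ v₄ : E8,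
        Omega0 (B v₁) (B v₂) (B v₃) (B v₄) = Omega0 v₁ v₂ v₃ v₄} := by
  have hset : {B : E8 →L[ℝ] E8 | Function.Bijective B ∧
      ∀ v₁ v₂ v₃ v₄ : E8,
        Omega0 (B v₁) (B v₂) (B v₃) (B v₄) = Omega0 v₁ v₂ v₃ v₄}
      = {B : E8 →L[ℝ] E8 | (∀ v, ‖B v‖ = ‖v‖) ∧ ∀ v₁ v₂ v₃ v₄ : E8,
        Omega0 (B v₁) (B v₂) (B v₃) (B v₄) = Omega0 v₁ v₂ v₃ v₄} := by
    ext B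
    constructor
    · rintro ⟨hb, h⟩
      exact ⟨isom B hb h, h⟩
    · rintro ⟨hn, h⟩
      have hinj : Function.Injective (B : E8 →ₗ[ℝ] E8) := by
        rw [injective_iff_map_eq_zero]
        intro x hx
        have := hn x
        rw [show B x = 0 from hx, norm_zero] at this
        exact norm_eq_zero.1 this.symm
      exact ⟨⟨hinj, LinearMap.injective_iff_surjective.1 hinj⟩, h⟩
  rw [hset]
  apply Metric.isCompact_of_isClosed_isBounded
  · simp only [Set.ofPred_and, Set.ofPred_forall]
    refine IsClosed.inter ?_ ?_
    · refine isClosed_iInter fun v => isClosed_eq ?_ continuous_const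
      fun_prop
    · refine isClosed_iInter fun a => isClosed_iInter fun b => isClosed_iInter fun c =>
        isClosed_iInter fun d => isClosed_eq (cont_Omega0 a b c d) continuous_const
  · refine (Metric.isBounded_closedBall (x := (0 : E8 →L[ℝ] E8)) (r := 1)).subset ?_
    rintro B ⟨hn, -⟩
    rw [mem_closedBall_zero_iff]
    exact B.opNorm_le_bound zero_le_one fun x => by rw [hn, one_mul]
end
end

section
/- Let B : ℝ⁸ → ℝ⁸ be a linear map with B ∘ B = id, B ≠ id, and B*Ω₀ = Ω₀. Then the fixed subspace ker(B − id) is either the zero subspace or a Cayley 4-plane: a 4-dimensional subspace admitting an orthonormal basis (e₁, e₂, e₃, e₄) with Ω₀(e₁, e₂, e₃, e₄) = 1. (This is the linear model behind the fact that each connected component of the fixed point set of a nontrivial isometric involution σ of a Spin(7)-manifold with σ*Ω = Ω is either a Cayley 4-fold or a single point.) -/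
open scoped RealInnerProductSpace

noncomputable section

/-- Octonion multiplication `a b`, as a map on `E8`. -/
def octL (a b : E8) : E8 := !₂[
    a 0 * b 0 - a 1 * b 1 - a 2 * b 2 - a 3 * b 3 - a 4 * b 4 - a 5 * b 5 - a 6 * b 6 - a 7 * b 7,
    a 0 * b 1 + a 1 * b 0 - a 2 * b 3 + a 3 * b 2 - a 4 * b 5 + a 5 * b 4 - a 6 * b 7 + a 7 * b 6,
    a 0 * b 2 + a 1 * b 3 + a 2 * b 0 - a 3 * b 1 - a 4 * b 6 + a 5 * b 7 + a 6 * b 4 - a 7 * b 5,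
    a 0 * b 3 - a 1 * b 2 + a 2 * b 1 + a 3 * b 0 + a 4 * b 7 + a 5 * b 6 - a 6 * b 5 - a 7 * b 4,
    a 0 * b 4 + a 1 * b 5 + a 2 * b 6 - a 3 * b 7 + a 4 * b 0 - a 5 * b 1 - a 6 * b 2 + a 7 * b 3,
    a 0 * b 5 - a 1 * b 4 - a 2 * b 7 - a 3 * b 6 + a 4 * b 1 + a 5 * b 0 + a 6 * b 3 + a 7 * b 2,
    a 0 * b 6 + a 1 * b 7 - a 2 * b 4 + a 3 * b 5 + a 4 * b 2 - a 5 * b 3 + a 6 * b 0 - a 7 * b 1,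
    a 0 * b 7 - a 1 * b 6 + a 2 * b 5 + a 3 * b 4 - a 4 * b 3 - a 5 * b 2 + a 6 * b 1 + a 7 * b 0]

/-- Octonion multiplication `conj a * b`, the transpose of `octL a`. -/
def octT (a b : E8) : E8 := !₂[
    a 0 * b 0 + a 1 * b 1 + a 2 * b 2 + a 3 * b 3 + a 4 * b 4 + a 5 * b 5 + a 6 * b 6 + a 7 * b 7,
    a 0 * b 1 - a 1 * b 0 + a 2 * b 3 - a 3 * b 2 + a 4 * b 5 - a 5 * b 4 + a 6 * b 7 - a 7 * b 6,
    a 0 * b 2 - a 1 * b 3 - a 2 * b 0 + a 3 * b 1 + a 4 * b 6 - a 5 * b 7 - a 6 * b 4 + a 7 * b 5,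
    a 0 * b 3 + a 1 * b 2 - a 2 * b 1 - a 3 * b 0 - a 4 * b 7 - a 5 * b 6 + a 6 * b 5 + a 7 * b 4,
    a 0 * b 4 - a 1 * b 5 - a 2 * b 6 + a 3 * b 7 - a 4 * b 0 + a 5 * b 1 + a 6 * b 2 - a 7 * b 3,
    a 0 * b 5 + a 1 * b 4 + a 2 * b 7 + a 3 * b 6 - a 4 * b 1 - a 5 * b 0 - a 6 * b 3 - a 7 * b 2,
    a 0 * b 6 - a 1 * b 7 + a 2 * b 4 - a 3 * b 5 - a 4 * b 2 + a 5 * b 3 - a 6 * b 0 + a 7 * b 1,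
    a 0 * b 7 + a 1 * b 6 - a 2 * b 5 - a 3 * b 4 + a 4 * b 3 + a 5 * b 2 - a 6 * b 1 - a 7 * b 0]

lemma inner8 (x y : E8) : ⟪x, y⟫ = x 0 * y 0 + x 1 * y 1 + x 2 * y 2 + x 3 * y 3
    + x 4 * y 4 + x 5 * y 5 + x 6 * y 6 + x 7 * y 7 := by
  simp [PiLp.inner_apply, Fin.sum_univ_eight, mul_comm]

lemma octT_sym (b c : E8) : octT b c + octT c b = (2 * ⟪b, c⟫) • !₂[1, 0, 0, 0, 0, 0, 0, 0] := by
  rw [inner8]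
  ext i
  fin_cases i <;> simp [octT] <;> ring

lemma octL_one (a : E8) : octL a !₂[1, 0, 0, 0, 0, 0, 0, 0] = a := by
  ext i
  fin_cases i <;> simp [octL]

lemma octL_add (a b c : E8) : octL a (b + c) = octL a b + octL a c := by
  ext i
  fin_cases i <;> simp [octL] <;> ring

lemma octL_smul (a b : E8) (r : ℝ) : octL a (r • b) = r • octL a b := by
  ext i
  fin_cases i <;> simp [octL] <;> ring

lemma octL_add_left (a b c : E8) : octL (a + b) c = octL a c + octL b c := by
  ext i
  fin_cases i <;> simp [octL] <;> ring

lemma octL_smul_left (a b : E8) (r : ℝ) : octL (r • a) b = r • octL a b := by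
  ext i
  fin_cases i <;> simp [octL] <;> ring

lemma octT_add (a b c : E8) : octT a (b + c) = octT a b + octT a c := by
  ext i
  fin_cases i <;> simp [octT] <;> ring

lemma octT_smul (a b : E8) (r : ℝ) : octT a (r • b) = r • octT a b := by
  ext i
  fin_cases i <;> simp [octT] <;> ring

lemma octT_add_left (a b c : E8) : octT (a + b) c = octT a c + octT b c := by
  ext i
  fin_cases i <;> simp [octT] <;> ring

lemma octT_smul_left (a b : E8) (r : ℝ) : octT (r • a) b = r • octT a b := by
  ext i
  fin_cases i <;> simp [octT] <;> ring

lemma oct_adj (a x y : E8) : ⟪octL a x, y⟫ = ⟪x, octT a y⟫ := by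
  simp only [inner8]
  simp [octL, octT]
  ring

lemma octT_octL (a x : E8) : octT a (octL a x) = ⟪a, a⟫ • x := by
  rw [inner8]
  ext i
  fin_cases i <;> simp [octL, octT] <;> ring

lemma octL_octT (a x : E8) : octL a (octT a x) = ⟪a, a⟫ • x := by
  rw [inner8]
  ext i
  fin_cases i <;> simp [octL, octT] <;> ring

/-- The triple product `a (conj b * c)`. -/
def tri (a b c : E8) : E8 := octL a (octT b c)

set_option maxHeartbeats 4000000 in
lemma Omega0_eq_s16 (a b c d : E8) : Omega0 a b c d = ⟪tri a b c, d⟫ - ⟪a, b⟫ * ⟪c, d⟫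
    + ⟪a, c⟫ * ⟪b, d⟫ - ⟪b, c⟫ * ⟪a, d⟫ := by
  simp only [inner8]
  simp [Omega0, quad8, Matrix.det_succ_row_zero, Fin.sum_univ_succ, Fin.succAbove, tri, octL, octT]
  ring

lemma tri_add₁ (a a' b c : E8) : tri (a + a') b c = tri a b c + tri a' b c := by
  simp [tri, octL_add_left]

lemma tri_add₂ (a b b' c : E8) : tri a (b + b') c = tri a b c + tri a b' c := by
  simp [tri, octT_add_left, octL_add]

lemma tri_add₃ (a b c c' : E8) : tri a b (c + c') = tri a b c + tri a b c' := by
  simp [tri, octT_add, octL_add]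

lemma tri_smul₁ (a b c : E8) (r : ℝ) : tri (r • a) b c = r • tri a b c := by
  simp [tri, octL_smul_left]

lemma tri_smul₂ (a b c : E8) (r : ℝ) : tri a (r • b) c = r • tri a b c := by
  simp [tri, octT_smul_left, octL_smul]

lemma tri_smul₃ (a b c : E8) (r : ℝ) : tri a b (r • c) = r • tri a b c := by
  simp [tri, octT_smul, octL_smul]

lemma tri_self (a c : E8) : tri a a c = ⟪a, a⟫ • c := octL_octT a c

lemma tri_swap₁₂ (a b c : E8) : tri a b c + tri b a c = (2 * ⟪a, b⟫) • c := by
  have h := tri_self (a + b) c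
  rw [tri_add₁, tri_add₂, tri_add₂, tri_self, tri_self, inner_add_left, inner_add_right,
    inner_add_right, real_inner_comm a b] at h
  have h' : tri a b c + tri b a c = (⟪a, a⟫ • c + tri a b c + (tri b a c + ⟪b, b⟫ • c))
    - ⟪a, a⟫ • c - ⟪b, b⟫ • c := by abel
  rw [h', h]
  module

lemma tri_swap₂₃ (a b c : E8) : tri a b c + tri a c b = (2 * ⟪b, c⟫) • a := by
  rw [tri, tri, ← octL_add, octT_sym, octL_smul, octL_one]

lemma tri_adj (a b c d : E8) : ⟪tri a b c, d⟫ = ⟪c, tri b a d⟫ := by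
  have h (x y : E8) : ⟪octT b x, y⟫ = ⟪x, octL b y⟫ := by
    rw [real_inner_comm, ← oct_adj, real_inner_comm]
  rw [tri, tri, oct_adj, h]

lemma tri_tri (a b c d : E8) : tri a b (tri b c d) = ⟪b, b⟫ • tri a c d := by
  rw [tri, tri, octT_octL, octL_smul, tri]

lemma tri_inner (a b c d : E8) : ⟪tri a b c, tri a b d⟫ = ⟪a, a⟫ * ⟪b, b⟫ * ⟪c, d⟫ := by
  rw [tri_adj, tri_tri, tri_self, smul_smul, inner_smul_right]

lemma tri_anti₁₂ {a b : E8} (h : ⟪a, b⟫ = 0) (c : E8) : tri a b c = - tri b a c := by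
  have := tri_swap₁₂ a b c
  rw [h] at this
  simp at this
  exact eq_neg_of_add_eq_zero_left this

lemma tri_anti₂₃ {b c : E8} (h : ⟪b, c⟫ = 0) (a : E8) : tri a b c = - tri a c b := by
  have := tri_swap₂₃ a b c
  rw [h] at this
  simp at this
  exact eq_neg_of_add_eq_zero_left this

lemma Omega0_tri {a b c : E8} (hab : ⟪a, b⟫ = 0) (hac : ⟪a, c⟫ = 0) (hbc : ⟪b, c⟫ = 0) (d : E8) :
    Omega0 a b c d = ⟪tri a b c, d⟫ := by
  rw [Omega0_eq_s16, hab, hac, hbc]; ring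

lemma Omega0_swap₁₂ (a b c d : E8) : Omega0 b a c d = - Omega0 a b c d := by
  have h := congrArg (fun z => ⟪z, d⟫) (tri_swap₁₂ a b c)
  simp only [inner_add_left, inner_smul_left] at h
  rw [Omega0_eq_s16, Omega0_eq_s16, real_inner_comm a b]
  simp at h
  linarith

lemma Omega0_swap₂₃ (a b c d : E8) : Omega0 a c b d = - Omega0 a b c d := by
  have h := congrArg (fun z => ⟪z, d⟫) (tri_swap₂₃ a b c)
  simp only [inner_add_left, inner_smul_left] at h
  rw [Omega0_eq_s16, Omega0_eq_s16, real_inner_comm b c]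
  simp at h
  linarith

lemma Omega0_add₃ (a b c c' d : E8) : Omega0 a b (c + c') d = Omega0 a b c d + Omega0 a b c' d := by
  simp only [Omega0_eq_s16, tri_add₃, inner_add_left, inner_add_right]
  ring

lemma Omega0_smul₃ (a b c d : E8) (r : ℝ) : Omega0 a b (r • c) d = r * Omega0 a b c d := by
  simp only [Omega0_eq_s16, tri_smul₃, real_inner_smul_left, real_inner_smul_right]
  ring

lemma Omega0_add₄ (a b c d d' : E8) : Omega0 a b c (d + d') = Omega0 a b c d + Omega0 a b c d' := by
  simp only [Omega0_eq_s16, inner_add_right]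
  ring

lemma Omega0_smul₄ (a b c d : E8) (r : ℝ) : Omega0 a b c (r • d) = r * Omega0 a b c d := by
  simp only [Omega0_eq_s16, real_inner_smul_right]
  ring

lemma Omega0_same₂₃ (a b d : E8) : Omega0 a b b d = 0 := by
  have := Omega0_swap₂₃ a b b d
  linarith

lemma Omega0_same₁₃ (a b d : E8) : Omega0 a b a d = 0 := by
  have := Omega0_swap₁₂ a a b d
  have := Omega0_swap₂₃ a a b d
  linarith

/-- Nondegeneracy of `Omega0 v w`. -/
lemma Omega0_nondeg {v w a : E8} (hv : v ≠ 0) (hvw : w ∉ Submodule.span ℝ {v})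
    (h : ∀ b, Omega0 v w a b = 0) : a ∈ Submodule.span ℝ {v, w} := by
  have hvv : ⟪v, v⟫ ≠ 0 := inner_self_ne_zero.mpr hv
  set s := ⟪v, w⟫ / ⟪v, v⟫ with hs
  set w' := w - s • v with hw'
  have hw0 : w' ≠ 0 := by
    intro h0
    apply hvw
    rw [Submodule.mem_span_singleton]
    exact ⟨s, (sub_eq_zero.mp h0).symm⟩
  have hww : ⟪w', w'⟫ ≠ 0 := inner_self_ne_zero.mpr hw0
  have hvw' : ⟪v, w'⟫ = 0 := by
    rw [hw', inner_sub_right, inner_smul_right, hs]; field_simp; ring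
  set p := ⟪v, a⟫ / ⟪v, v⟫ with hp
  set q := ⟪w', a⟫ / ⟪w', w'⟫ with hq
  set a' := a - p • v - q • w' with ha'
  have hwv' : ⟪w', v⟫ = 0 := by rw [real_inner_comm, hvw']
  have hva : ⟪v, a'⟫ = 0 := by
    rw [ha', inner_sub_right, inner_sub_right, inner_smul_right, inner_smul_right, hvw', hp]
    field_simp; ring
  have hwa : ⟪w', a'⟫ = 0 := by
    rw [ha', inner_sub_right, inner_sub_right, inner_smul_right, inner_smul_right, hwv', hq]
    field_simp; ring
  have hw2 : w = w' + s • v := by rw [hw']; abel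
  have ha2 : a = a' + p • v + q • w' := by rw [ha']; abel
  have key : tri v w' a' = 0 := by
    rw [← inner_self_eq_zero (𝕜 := ℝ), ← Omega0_tri hvw' hva hwa, ← h (tri v w' a')]
    have e1 (b : E8) : Omega0 v w a b = Omega0 v w' a b := by
      rw [Omega0_swap₂₃, Omega0_swap₂₃ v a w', hw2, Omega0_add₃, Omega0_smul₃, Omega0_same₁₃]
      ring
    rw [e1, ha2, Omega0_add₃, Omega0_add₃, Omega0_smul₃, Omega0_smul₃, Omega0_same₁₃,
      Omega0_same₂₃]
    ring
  have h3 := tri_inner v w' a' a'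
  rw [key, inner_zero_left] at h3
  have : a' = 0 := by
    rw [← inner_self_eq_zero (𝕜 := ℝ)]
    have := mul_ne_zero hvv hww
    by_contra hne
    exact mul_ne_zero this hne h3.symm
  rw [Submodule.mem_span_pair]
  refine ⟨p - q * s, q, ?_⟩
  rw [ha2, this, hw']
  module

lemma orthonormal4 {a b c d : E8} (haa : ⟪a, a⟫ = 1) (hbb : ⟪b, b⟫ = 1) (hcc : ⟪c, c⟫ = 1)
    (hdd : ⟪d, d⟫ = 1) (hab : ⟪a, b⟫ = 0) (hac : ⟪a, c⟫ = 0) (had : ⟪a, d⟫ = 0)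
    (hbc : ⟪b, c⟫ = 0) (hbd : ⟪b, d⟫ = 0) (hcd : ⟪c, d⟫ = 0) : Orthonormal ℝ ![a, b, c, d] := by
  have hba := (real_inner_comm a b).trans hab
  have hca := (real_inner_comm a c).trans hac
  have hda := (real_inner_comm a d).trans had
  have hcb := (real_inner_comm b c).trans hbc
  have hdb := (real_inner_comm b d).trans hbd
  have hdc := (real_inner_comm c d).trans hcd
  rw [orthonormal_iff_ite]
  intro i j
  fin_cases i <;> fin_cases j <;>
    simp [haa, hbb, hcc, hdd, hab, hac, had, hbc, hbd, hcd, hba, hca, hda, hcb, hdb, hdc,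
      -inner_self_eq_norm_sq_to_K]

lemma Omega0_same₂₄ (v w a : E8) : Omega0 v w a w = 0 := by
  have h1 := tri_swap₂₃ w v w
  rw [tri_self] at h1
  have h2 : tri w v w = (2 * ⟪v, w⟫) • w - ⟪w, w⟫ • v := by rw [← h1]; abel
  rw [Omega0_eq_s16, tri_adj, h2, inner_sub_right, real_inner_smul_right, real_inner_smul_right,
    real_inner_comm w a, real_inner_comm v a]
  ring

lemma Omega0_neg₁ (a b c d : E8) : Omega0 (-a) b c d = - Omega0 a b c d := by
  rw [← neg_one_smul ℝ a]
  simp only [Omega0_eq_s16, tri_smul₁, real_inner_smul_left]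
  ring

lemma Omega0_neg₂ (a b c d : E8) : Omega0 a (-b) c d = - Omega0 a b c d := by
  rw [← neg_one_smul ℝ b]
  simp only [Omega0_eq_s16, tri_smul₂, real_inner_smul_left, real_inner_smul_right]
  ring

lemma Omega0_neg₃ (a b c d : E8) : Omega0 a b (-c) d = - Omega0 a b c d := by
  rw [← neg_one_smul ℝ c, Omega0_smul₃]
  ring

lemma Omega0_neg₄ (a b c d : E8) : Omega0 a b c (-d) = - Omega0 a b c d := by
  rw [← neg_one_smul ℝ d, Omega0_smul₄]
  ring

lemma finrank_le_of_split (U W : Submodule ℝ E8) (hUW : Disjoint U W) (hUW' : U ⊔ W = ⊤)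
    (hz : ∀ v ∈ U, ∀ w ∈ W, ∀ a ∈ U, ∀ b ∈ U, Omega0 v w a b = 0)
    (v w : E8) (hv : v ∈ U) (hv0 : v ≠ 0) (hw : w ∈ W) (hw0 : w ≠ 0) :
    Module.finrank ℝ U ≤ Module.finrank ℝ W := by
  have hd := Submodule.disjoint_def.mp hUW
  let f : U →ₗ[ℝ] Module.Dual ℝ W := LinearMap.mk₂ ℝ (fun a b => Omega0 v w a b)
    (fun a a' b => Omega0_add₃ v w a a' b) (fun r a b => Omega0_smul₃ v w a b r)
    (fun a b b' => Omega0_add₄ v w a b b') (fun r a b => Omega0_smul₄ v w a b r)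
  have hf (a : U) (b : W) : f a b = Omega0 v w a b := rfl
  have hker : LinearMap.ker f ≤ Submodule.span ℝ {(⟨v, hv⟩ : U)} := by
    intro a ha
    have hall : ∀ b, Omega0 v w a b = 0 := by
      intro b
      have hb : b ∈ U ⊔ W := by rw [hUW']; trivial
      obtain ⟨x, hx, y, hy, rfl⟩ := Submodule.mem_sup.mp hb
      rw [Omega0_add₄, hz v hv w hw a a.2 x hx]
      have h1 := hf a ⟨y, hy⟩
      rw [LinearMap.mem_ker.mp ha] at h1
      simp at h1
      linarith
    have hns : w ∉ Submodule.span ℝ {v} := by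
      intro h
      exact hw0 (hd w ((Submodule.span_singleton_le_iff_mem v U).mpr hv h) hw)
    obtain ⟨p, q, hpq⟩ := Submodule.mem_span_pair.mp (Omega0_nondeg hv0 hns hall)
    have hq : q • w = 0 := by
      apply hd _ _ (W.smul_mem q hw)
      have : q • w = (a : E8) - p • v := by rw [← hpq]; abel
      rw [this]
      exact U.sub_mem a.2 (U.smul_mem p hv)
    rw [Submodule.mem_span_singleton]
    refine ⟨p, Subtype.ext ?_⟩
    rw [← hpq, hq]
    simp
  have h1 : Module.finrank ℝ (LinearMap.ker f) ≤ 1 :=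
    (Submodule.finrank_mono hker).trans ((finrank_span_le_card _).trans (by simp))
  have h2 : LinearMap.range f < ⊤ := by
    rw [lt_top_iff_ne_top]
    intro h
    have hwne : (⟨w, hw⟩ : W) ≠ 0 := fun h => hw0 (congrArg Subtype.val h)
    apply hwne
    rw [← Module.forall_dual_apply_eq_zero_iff ℝ]
    intro φ
    have hφ : φ ∈ LinearMap.range f := by rw [h]; trivial
    obtain ⟨a, rfl⟩ := hφ
    rw [hf]
    exact Omega0_same₂₄ v w a
  have h3 := Submodule.finrank_lt h2.ne
  rw [Subspace.dual_finrank_eq] at h3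
  have h4 := LinearMap.finrank_range_add_finrank_ker f
  omega

lemma tri_aux {e₁ e₂ e₃ e₄ : E8} {c : ℝ}
    (h11 : ⟪e₁, e₁⟫ = 1) (h22 : ⟪e₂, e₂⟫ = 1) (h33 : ⟪e₃, e₃⟫ = 1) (h44 : ⟪e₄, e₄⟫ = 1)
    (h12 : ⟪e₁, e₂⟫ = 0) (h13 : ⟪e₁, e₃⟫ = 0) (h14 : ⟪e₁, e₄⟫ = 0)
    (h34 : ⟪e₃, e₄⟫ = 0)
    (hr1 : ⟪e₁, tri e₁ e₃ e₄⟫ = 0) (hr2 : ⟪e₂, tri e₁ e₃ e₄⟫ = c)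
    (hr3 : ⟪e₃, tri e₁ e₃ e₄⟫ = 0) (hr4 : ⟪e₄, tri e₁ e₃ e₄⟫ = 0) :
    tri e₁ (e₂ - c • tri e₁ e₃ e₄) (e₃ + c • tri e₁ e₂ e₄) =
      (1 - c ^ 2) • (tri e₁ e₂ e₃ - (2 * c) • e₄) := by
  have k1 : tri e₁ e₂ (tri e₁ e₂ e₄) = - e₄ := by
    rw [tri_anti₁₂ h12 (tri e₁ e₂ e₄), tri_tri, tri_self, h11, h22]; simp
  have k2 : tri e₁ (tri e₁ e₃ e₄) e₃ = e₄ := by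
    rw [tri_anti₂₃ (by rw [real_inner_comm, hr3]), tri_anti₁₂ h13 (tri e₁ e₃ e₄), tri_tri, tri_self,
      h11, h33]
    simp
  have k3 : tri e₁ (tri e₁ e₃ e₄) (tri e₁ e₂ e₄) = tri e₁ e₂ e₃ - (2 * c) • e₄ := by
    set r := tri e₁ e₃ e₄ with hr
    have hr' : r = tri e₄ e₁ e₃ := by
      rw [hr, tri_anti₂₃ h34, tri_anti₁₂ h14, neg_neg]
    have s1 := tri_swap₁₂ e₂ r e₄
    rw [hr2] at s1
    have s2 : tri e₂ r e₄ = tri e₁ e₂ e₃ := by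
      rw [tri_anti₂₃ (by rw [real_inner_comm, hr4]), hr', tri_tri, h44, one_smul, ← tri_anti₁₂ h12]
    rw [tri_anti₁₂ hr1, tri_tri, h11, one_smul, ← s1, s2]
    abel
  have hm : ∀ x y : E8, x - y = x + (-1 : ℝ) • y := fun x y => by module
  rw [hm e₂]
  simp only [tri_add₂, tri_add₃, tri_smul₂, tri_smul₃, k1, k2, k3]
  module

lemma Omega0_pm_one (U W : Submodule ℝ E8) (hUW : Disjoint U W)
    (hW : Module.finrank ℝ W = 4)
    (hz1 : ∀ a ∈ U, ∀ b ∈ U, ∀ d ∈ U, ∀ w ∈ W, Omega0 a b d w = 0)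
    (hz3 : ∀ a ∈ U, ∀ x ∈ W, ∀ y ∈ W, ∀ z ∈ W, Omega0 a x y z = 0)
    {e₁ e₂ e₃ e₄ : E8} (m1 : e₁ ∈ U) (m2 : e₂ ∈ U) (m3 : e₃ ∈ U) (m4 : e₄ ∈ U)
    (h11 : ⟪e₁, e₁⟫ = 1) (h22 : ⟪e₂, e₂⟫ = 1) (h33 : ⟪e₃, e₃⟫ = 1) (h44 : ⟪e₄, e₄⟫ = 1)
    (h12 : ⟪e₁, e₂⟫ = 0) (h13 : ⟪e₁, e₃⟫ = 0) (h14 : ⟪e₁, e₄⟫ = 0)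
    (h23 : ⟪e₂, e₃⟫ = 0) (h24 : ⟪e₂, e₄⟫ = 0) (h34 : ⟪e₃, e₄⟫ = 0) :
    Omega0 e₁ e₂ e₃ e₄ = 1 ∨ Omega0 e₁ e₂ e₃ e₄ = -1 := by
  have hd := Submodule.disjoint_def.mp hUW
  set c := Omega0 e₁ e₂ e₃ e₄ with hc
  have h21 : ⟪e₂, e₁⟫ = 0 := by rw [real_inner_comm, h12]
  have h31 : ⟪e₃, e₁⟫ = 0 := by rw [real_inner_comm, h13]
  have h41 : ⟪e₄, e₁⟫ = 0 := by rw [real_inner_comm, h14]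
  have h32 : ⟪e₃, e₂⟫ = 0 := by rw [real_inner_comm, h23]
  have h42 : ⟪e₄, e₂⟫ = 0 := by rw [real_inner_comm, h24]
  have h43 : ⟪e₄, e₃⟫ = 0 := by rw [real_inner_comm, h34]
  -- orthogonality of a triple product to its arguments
  have perp3 {x y z : E8} (hxy : ⟪x, y⟫ = 0) : ⟪z, tri x y z⟫ = 0 := by
    have h1 := tri_adj x y z z
    have h2 := congrArg (fun t => ⟪z, t⟫) (tri_swap₁₂ x y z)
    simp only [inner_add_right, inner_smul_right, hxy] at h2
    rw [real_inner_comm] at h1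
    linarith
  have perp2 {x y z : E8} (hxz : ⟪x, z⟫ = 0) (hyz : ⟪y, z⟫ = 0) : ⟪y, tri x y z⟫ = 0 := by
    rw [tri_anti₂₃ hyz, inner_neg_right, perp3 hxz, neg_zero]
  have perp1 {x y z : E8} (hxy : ⟪x, y⟫ = 0) (hxz : ⟪x, z⟫ = 0) (hyz : ⟪y, z⟫ = 0) :
      ⟪x, tri x y z⟫ = 0 := by
    rw [tri_anti₁₂ hxy, inner_neg_right, perp2 hyz hxz, neg_zero]
  have c123 : ⟪e₄, tri e₁ e₂ e₃⟫ = c := by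
    rw [real_inner_comm, ← Omega0_tri h12 h13 h23]
  have c124 : ⟪e₃, tri e₁ e₂ e₄⟫ = -c := by
    rw [hc, Omega0_tri h12 h13 h23, tri_adj, tri_anti₁₂ h21, inner_neg_right, neg_neg]
  have c134 : ⟪e₂, tri e₁ e₃ e₄⟫ = c := by
    rw [← tri_adj e₃ e₁, tri_anti₁₂ h31, tri_anti₂₃ h32, neg_neg, real_inner_comm, c123]
  have c234 : ⟪e₁, tri e₂ e₃ e₄⟫ = -c := by
    rw [← tri_adj e₃ e₂, tri_anti₂₃ h21, tri_anti₁₂ h31, neg_neg, tri_anti₂₃ h32, inner_neg_left,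
      real_inner_comm, c123]
  have n123 : ⟪tri e₁ e₂ e₃, tri e₁ e₂ e₃⟫ = 1 := by rw [tri_inner, h11, h22, h33]; norm_num
  have n124 : ⟪tri e₁ e₂ e₄, tri e₁ e₂ e₄⟫ = 1 := by rw [tri_inner, h11, h22, h44]; norm_num
  have n134 : ⟪tri e₁ e₃ e₄, tri e₁ e₃ e₄⟫ = 1 := by rw [tri_inner, h11, h33, h44]; norm_num
  have n234 : ⟪tri e₂ e₃ e₄, tri e₂ e₃ e₄⟫ = 1 := by rw [tri_inner, h22, h33, h44]; norm_num
  have o1 : ⟪tri e₁ e₂ e₃, tri e₁ e₂ e₄⟫ = 0 := by rw [tri_inner, h34, mul_zero]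
  have o2 : ⟪tri e₁ e₂ e₃, tri e₁ e₃ e₄⟫ = 0 := by
    rw [tri_anti₂₃ h23, inner_neg_left, tri_inner, h24, mul_zero, neg_zero]
  have o3 : ⟪tri e₁ e₂ e₃, tri e₂ e₃ e₄⟫ = 0 := by
    rw [tri_anti₁₂ h12, tri_anti₂₃ h13, neg_neg, tri_inner, h14, mul_zero]
  have o4 : ⟪tri e₁ e₂ e₄, tri e₁ e₃ e₄⟫ = 0 := by
    rw [tri_anti₂₃ h24, tri_anti₂₃ h34, inner_neg_left, inner_neg_right, tri_inner, h23, mul_zero,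
      neg_zero, neg_zero]
  have o5 : ⟪tri e₁ e₂ e₄, tri e₂ e₃ e₄⟫ = 0 := by
    rw [tri_anti₁₂ h12, tri_anti₂₃ h14, neg_neg, tri_anti₂₃ h34, inner_neg_right, tri_inner, h13,
      mul_zero, neg_zero]
  have o6 : ⟪tri e₁ e₃ e₄, tri e₂ e₃ e₄⟫ = 0 := by
    rw [tri_anti₁₂ h13, tri_anti₂₃ h14, neg_neg, tri_anti₁₂ h23, tri_anti₂₃ h24, neg_neg,
      tri_inner, h12, mul_zero]
  have o1' := (real_inner_comm (tri e₁ e₂ e₃) (tri e₁ e₂ e₄)).trans o1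
  have o2' := (real_inner_comm (tri e₁ e₂ e₃) (tri e₁ e₃ e₄)).trans o2
  have o4' := (real_inner_comm (tri e₁ e₂ e₄) (tri e₁ e₃ e₄)).trans o4
  -- the four triple products are an orthonormal basis of the orthogonal complement of `W`
  have hmem {u : E8} (g123 : ⟪u, tri e₁ e₂ e₃⟫ = 0) (g124 : ⟪u, tri e₁ e₂ e₄⟫ = 0)
      (g134 : ⟪u, tri e₁ e₃ e₄⟫ = 0) (g234 : ⟪u, tri e₂ e₃ e₄⟫ = 0) : u ∈ W := by
    have hon : Orthonormal ℝ ![tri e₁ e₂ e₃, tri e₁ e₂ e₄, tri e₁ e₃ e₄, tri e₂ e₃ e₄] := by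
      exact orthonormal4 n123 n124 n134 n234 o1 o2 o3 o4 o5 o6
    have hli := hon.linearIndependent
    have hfr := finrank_span_eq_card hli
    have hle : Submodule.span ℝ (Set.range ![tri e₁ e₂ e₃, tri e₁ e₂ e₄, tri e₁ e₃ e₄,
        tri e₂ e₃ e₄]) ≤ Wᗮ := by
      rw [Submodule.span_le]
      rintro _ ⟨i, rfl⟩
      rw [SetLike.mem_coe, Submodule.mem_orthogonal']
      intro w hw
      fin_cases i
      · simpa [Omega0_tri h12 h13 h23] using hz1 e₁ m1 e₂ m2 e₃ m3 w hw
      · simpa [Omega0_tri h12 h14 h24] using hz1 e₁ m1 e₂ m2 e₄ m4 w hw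
      · simpa [Omega0_tri h13 h14 h34] using hz1 e₁ m1 e₃ m3 e₄ m4 w hw
      · simpa [Omega0_tri h23 h24 h34] using hz1 e₂ m2 e₃ m3 e₄ m4 w hw
    have hWp : Module.finrank ℝ Wᗮ = 4 := by
      have := Submodule.finrank_add_finrank_orthogonal W
      simp [hW] at this
      omega
    have heq := Submodule.eq_of_le_of_finrank_eq hle (by rw [hfr, hWp]; simp)
    rw [← Submodule.orthogonal_orthogonal W, ← heq, Submodule.mem_orthogonal']
    intro t ht
    induction ht using Submodule.span_induction with
    | mem x hx =>
      obtain ⟨i, rfl⟩ := hx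
      fin_cases i <;> simp [g123, g124, g134, g234]
    | zero => simp
    | add x y _ _ hx hy => rw [inner_add_right, hx, hy, add_zero]
    | smul r x _ hx => rw [inner_smul_right, hx, mul_zero]
  have p1 := perp1 h12 h13 h23
  have p2 := perp2 h13 h23 (x := e₁)
  have p3 := perp3 h12 (z := e₃)
  have q1 := perp1 h12 h14 h24
  have q2 := perp2 h14 h24 (x := e₁)
  have q4 := perp3 h12 (z := e₄)
  have r1 := perp1 h13 h14 h34
  have r3 := perp2 h14 h34 (x := e₁)
  have r4 := perp3 h13 (z := e₄)
  have s2 := perp1 h23 h24 h34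
  have s3 := perp2 h24 h34 (x := e₂)
  have s4 := perp3 h23 (z := e₄)
  have u4 : e₄ - c • tri e₁ e₂ e₃ ∈ W := by
    apply hmem <;>
    simp only [inner_sub_left, real_inner_smul_left, n123, o1, o2, o3, c123, q4, r4, s4] <;> ring
  have u3 : e₃ + c • tri e₁ e₂ e₄ ∈ W := by
    apply hmem <;>
    simp only [inner_add_left, real_inner_smul_left, n124, o1', o4, o5, c124, p3, r3, s3] <;> ring
  have u2 : e₂ - c • tri e₁ e₃ e₄ ∈ W := by
    apply hmem <;>
    simp only [inner_sub_left, real_inner_smul_left, n134, o2', o4', o6, c134, p2, q2, s2] <;> ring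
  have key := hz3 e₁ m1 _ u2 _ u3 _ u4
  have r3' := (real_inner_comm e₃ (tri e₁ e₃ e₄)).trans r3
  have c123' := (real_inner_comm e₄ (tri e₁ e₂ e₃)).trans c123
  rw [Omega0_tri, tri_aux h11 h22 h33 h44 h12 h13 h14 h34 r1 c134 r3 r4] at key
  · simp only [real_inner_smul_left, inner_sub_left, inner_sub_right, real_inner_smul_right,
      n123, c123, c123', h44] at key
    have hc0 : c ≠ 0 := by
      intro h0
      rw [h0, zero_smul, sub_zero] at u4
      have := hd e₄ m4 u4
      rw [this] at h44
      simp at h44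
    have hfac : c * ((c - 1) * (c + 1)) ^ 2 = 0 := by linear_combination (-1 / 2) * key
    have h5 := pow_eq_zero_iff (two_ne_zero) |>.mp ((mul_eq_zero.mp hfac).resolve_left hc0)
    rcases mul_eq_zero.mp h5 with h | h
    · left; linarith
    · right; linarith
  · simp only [inner_sub_right, real_inner_smul_right, h12, r1]; ring
  · simp only [inner_add_right, real_inner_smul_right, h13, q1]; ring
  · simp only [inner_sub_left, real_inner_smul_left, inner_add_right, real_inner_smul_right, h23,
      q2, r3', o4']; ring

/-- If B : ℝ⁸ → ℝ⁸ is a nontrivial linear involution preserving Ω₀, then its fixed subspace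
is either zero or a Cayley 4-plane: a 4-dimensional subspace with an orthonormal basis
(e₁,e₂,e₃,e₄) on which Ω₀ takes the value 1. -/
theorem fixed_set_of_involution_cayley
    (B : E8 →ₗ[ℝ] E8) (h2 : B ∘ₗ B = LinearMap.id) (hne : B ≠ LinearMap.id)
    (hOmega : ∀ v₁ v₂ v₃ v₄ : E8,
      Omega0 (B v₁) (B v₂) (B v₃) (B v₄) = Omega0 v₁ v₂ v₃ v₄) :
    LinearMap.ker (B - LinearMap.id) = ⊥ ∨
    (Module.finrank ℝ (LinearMap.ker (B - LinearMap.id)) = 4 ∧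
      ∃ e₁ e₂ e₃ e₄ : E8,
        e₁ ∈ LinearMap.ker (B - LinearMap.id) ∧
        e₂ ∈ LinearMap.ker (B - LinearMap.id) ∧
        e₃ ∈ LinearMap.ker (B - LinearMap.id) ∧
        e₄ ∈ LinearMap.ker (B - LinearMap.id) ∧
        Orthonormal ℝ ![e₁, e₂, e₃, e₄] ∧ Omega0 e₁ e₂ e₃ e₄ = 1) := by
  set U := LinearMap.ker (B - LinearMap.id) with hU
  set W := LinearMap.ker (B + LinearMap.id) with hW
  have mU (x : E8) : x ∈ U ↔ B x = x := by
    rw [hU, LinearMap.mem_ker, LinearMap.sub_apply, LinearMap.id_apply, sub_eq_zero]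
  have mW (x : E8) : x ∈ W ↔ B x = -x := by
    rw [hW, LinearMap.mem_ker, LinearMap.add_apply, LinearMap.id_apply, add_eq_zero_iff_eq_neg]
  have hBB (x : E8) : B (B x) = x := by
    have := LinearMap.congr_fun h2 x
    simpa using this
  have hdisj : Disjoint U W := by
    rw [Submodule.disjoint_def]
    intro x hx hx'
    rw [mU] at hx
    rw [mW, hx] at hx'
    have h3 : x = (1 / 2 : ℝ) • (x - -x) := by module
    rw [h3, ← hx', sub_self, smul_zero]
  have hsup : U ⊔ W = ⊤ := by
    rw [eq_top_iff]
    intro x _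
    rw [Submodule.mem_sup]
    refine ⟨(1 / 2 : ℝ) • (x + B x), ?_, (1 / 2 : ℝ) • (x - B x), ?_, ?_⟩
    · rw [mU, map_smul, map_add, hBB, add_comm]
    · rw [mW, map_smul, map_sub, hBB]
      module
    · module
  by_cases hU0 : U = ⊥
  · exact Or.inl hU0
  right
  have hW0 : W ≠ ⊥ := by
    intro h
    apply hne
    ext1 x
    have hx : x ∈ U := by
      rw [h, sup_bot_eq] at hsup
      rw [hsup]
      trivial
    exact (mU x).mp hx
  obtain ⟨v, hv, hv0⟩ := Submodule.exists_mem_ne_zero_of_ne_bot hU0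
  obtain ⟨w, hw, hw0⟩ := Submodule.exists_mem_ne_zero_of_ne_bot hW0
  have hle1 : Module.finrank ℝ U ≤ Module.finrank ℝ W := by
    refine finrank_le_of_split U W hdisj hsup ?_ v w hv hv0 hw hw0
    intro v hv w hw a ha b hb
    have h := hOmega v w a b
    rw [(mU v).mp hv, (mW w).mp hw, (mU a).mp ha, (mU b).mp hb, Omega0_neg₂] at h
    linarith
  have hle2 : Module.finrank ℝ W ≤ Module.finrank ℝ U := by
    refine finrank_le_of_split W U hdisj.symm (by rw [sup_comm, hsup]) ?_ w v hw hw0 hv hv0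
    intro v hv w hw a ha b hb
    have h := hOmega v w a b
    rw [(mW v).mp hv, (mU w).mp hw, (mW a).mp ha, (mW b).mp hb, Omega0_neg₁, Omega0_neg₃,
      Omega0_neg₄] at h
    linarith
  have hsum : Module.finrank ℝ U + Module.finrank ℝ W = 8 := by
    rw [Submodule.finrank_add_eq_of_isCompl ⟨hdisj, codisjoint_iff.mpr hsup⟩]
    simp
  have hU4 : Module.finrank ℝ U = 4 := by omega
  have hW4 : Module.finrank ℝ W = 4 := by omega
  refine ⟨hU4, ?_⟩
  let β := (stdOrthonormalBasis ℝ U).reindex (finCongr hU4)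
  have hβ (i j : Fin 4) : ⟪(β i : E8), (β j : E8)⟫ = if i = j then 1 else 0 := by
    rw [← Submodule.coe_inner]
    exact orthonormal_iff_ite.mp β.orthonormal i j
  have hpm := Omega0_pm_one U W hdisj hW4
    (fun a ha b hb d hd w hw => by
      have h := hOmega a b d w
      rw [(mU a).mp ha, (mU b).mp hb, (mU d).mp hd, (mW w).mp hw, Omega0_neg₄] at h
      linarith)
    (fun a ha x hx y hy z hz => by
      have h := hOmega a x y z
      rw [(mU a).mp ha, (mW x).mp hx, (mW y).mp hy, (mW z).mp hz, Omega0_neg₂, Omega0_neg₃,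
        Omega0_neg₄] at h
      linarith)
    (β 0).2 (β 1).2 (β 2).2 (β 3).2 (by rw [hβ]; simp) (by rw [hβ]; simp) (by rw [hβ]; simp) (by rw [hβ]; simp)
    (by rw [hβ]; simp) (by rw [hβ]; simp) (by rw [hβ]; simp) (by rw [hβ]; simp) (by rw [hβ]; simp) (by rw [hβ]; simp)
  rcases hpm with h | h
  · refine ⟨β 0, β 1, β 2, β 3, (β 0).2, (β 1).2, (β 2).2, (β 3).2, ?_, h⟩
    apply orthonormal4 <;> rw [hβ] <;> simp
  · refine ⟨β 0, β 1, β 2, -(β 3 : E8), (β 0).2, (β 1).2, (β 2).2, U.neg_mem (β 3).2, ?_, ?_⟩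
    · apply orthonormal4 <;> simp only [inner_neg_left, inner_neg_right, hβ] <;> simp
    · rw [Omega0_neg₄, h, neg_neg]
end
end
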